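/- Let n ≥ 3 and suppose q and m are positive integers with T_{n-1} + T_q = T_m. Set k = q + m - n. Then k is a positive integer, and n+k+1 divides (k+1)n + k(k+1)/2 with quotient exactly q; that is, (k+1)n + k(k+1)/2 = q·(n+k+1). -/

import Mathlib

/-- The triangular number `T m = m(m+1)/2`. -/
def T (m : ℕ) : ℕ := m * (m + 1) / 2

/-- Doubling clears the division in the definition of `T`. -/
theorem two_mul_T (m : ℕ) : 2 * T m = m * (m + 1) :=
  Nat.mul_div_cancel' (Nat.even_mul_succ_self m).two_dvd

/-- Let `n ≥ 3` and let `q, m` be positive integers with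
`T (n-1) + T q = T m`. Set `k = q + m - n`. Then `k` is a positive integer and
`(k+1)n + k(k+1)/2 = q·(n+k+1)`; in particular `n+k+1` divides `(k+1)n + k(k+1)/2`
with quotient exactly `q`. -/
theorem triangular_gives_quotient (n q m k : ℕ) (hn : 3 ≤ n)
    (hq : 0 < q) (hm : 0 < m) (h : T (n - 1) + T q = T m)
    (hk : k = q + m - n) :
    0 < k ∧ (k + 1) * n + k * (k + 1) / 2 = q * (n + k + 1) := by
  have hT : (n - 1) * (n - 1 + 1) + q * (q + 1) = m * (m + 1) := by
    rw [← two_mul_T, ← two_mul_T, ← two_mul_T, ← h, mul_add]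
  have hkT : 2 * (k * (k + 1) / 2) = k * (k + 1) := two_mul_T k
  obtain ⟨a, rfl⟩ : ∃ a, n = a + 1 := ⟨n - 1, by omega⟩
  rw [Nat.add_sub_cancel] at hT
  have ham : a < m := by
    by_contra! hle
    nlinarith
  obtain ⟨d, rfl⟩ : ∃ d, m = a + 1 + d := ⟨m - (a + 1), by omega⟩
  obtain rfl : k = q + d := by omega
  refine ⟨by omega, ?_⟩
  nlinarith
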